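/- If d divides n, d divides s, and d divides ℓ = n/m, then there is a bijection between (m+2)-angulations of P_n^• with s spokes that are fixed by rotation through angle 2π/d and (m+2)-angulations of P_{n/d}^• with s/d spokes. Consequently the number of fixed points equals m·C(n/d + ℓ/d - s/d - 1, n/d - 1). -/

import Mathlib

/-- An arc on the once-punctured polygon `P_n^•`: either a spoke from boundary
vertex `i` to the puncture, or the peripheral arc from `i` clockwise to `j`
(cut off region without the puncture); `per i i` is the loop at `i` cutting out a
once-punctured monogon. -/
inductive PArc (n : ℕ) where
  | spoke (i : Fin n)
  | per (i j : Fin n)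
deriving DecidableEq

namespace PArc

/-- Clockwise distance from `i` to `j` on the boundary. -/
def gp (n : ℕ) (i j : Fin n) : ℕ := (j.val + n - i.val) % n

/-- The clockwise length of the peripheral arc from `i` to `j` (`n` for the loop). -/
def len (n : ℕ) (i j : Fin n) : ℕ := if i = j then n else (j.val + n - i.val) % n

/-- An arc is valid (not isotopic to a boundary segment). -/
def Valid {n : ℕ} : PArc n → Prop
  | .spoke _ => True
  | .per i j => 2 ≤ len n i j

/-- Two arcs cross (have essential intersection); computed via their lifts to the
universal cover (an infinite strip with vertices `ℤ`, a peripheral arc `per i j`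
lifting to chords `(a, a + len i j)` for `a ≡ i (mod n)` and a spoke lifting to
downward rays at positions `≡ i (mod n)`). -/
def Cross {n : ℕ} : PArc n → PArc n → Prop
  | .spoke _, .spoke _ => False
  | .spoke s, .per i j => 0 < gp n i s ∧ gp n i s < len n i j
  | .per i j, .spoke s => 0 < gp n i s ∧ gp n i s < len n i j
  | .per i j, .per k l =>
      (0 < gp n i k ∧ gp n i k < len n i j ∧ len n i j < gp n i k + len n k l) ∨
      (0 < gp n k i ∧ gp n k i < len n k l ∧ len n k l < gp n k i + len n i j)

def isSpoke {n : ℕ} : PArc n → Bool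
  | .spoke _ => true
  | .per _ _ => false

end PArc

/-- `(a, b)` is a lift (to the strip with vertices `ℤ`) of a peripheral arc of `T`. -/
def IsChord {n : ℕ} (T : Finset (PArc n)) (a b : ℤ) : Prop :=
  ∃ i j : Fin n, PArc.per i j ∈ T ∧ ∃ t : ℤ, a = (i.val : ℤ) + t * n ∧ b = a + PArc.len n i j

/-- `a` is the position of a lift of a spoke of `T`. -/
def IsRay {n : ℕ} (T : Finset (PArc n)) (a : ℤ) : Prop :=
  ∃ s : Fin n, PArc.spoke s ∈ T ∧ ∃ t : ℤ, a = (s.val : ℤ) + t * n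

/-- `a` and `b` are joined by a boundary edge or a lifted chord. -/
def IsEdge {n : ℕ} (T : Finset (PArc n)) (a b : ℤ) : Prop :=
  b = a + 1 ∨ IsChord T a b

/-- `a < b` are consecutive elements of `S`. -/
def ConsecIn (S : Finset ℤ) (a b : ℤ) : Prop :=
  a ∈ S ∧ b ∈ S ∧ a < b ∧ ∀ x ∈ S, ¬(a < x ∧ x < b)

/-- `S` is the vertex set of a finite face (a subgon not containing the puncture)
of the lift of `T` to the strip. -/
def IsFinFace {n : ℕ} (T : Finset (PArc n)) (S : Finset ℤ) : Prop :=
  3 ≤ S.card ∧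
  (∀ u v : ℤ, ConsecIn S u v → IsEdge T u v) ∧
  (∃ a ∈ S, ∃ b ∈ S, (∀ x ∈ S, a ≤ x ∧ x ≤ b) ∧ IsChord T a b ∧
    ∀ u ∈ S, ∀ v ∈ S, u < v → IsChord T u v → (u = a ∧ v = b) ∨ ConsecIn S u v)

/-- Vertex `x` of the strip is strictly covered by some lifted chord of `T`. -/
def Covered {n : ℕ} (T : Finset (PArc n)) (x : ℤ) : Prop :=
  ∃ a b : ℤ, IsChord T a b ∧ a < x ∧ x < b

/-- `T` is an `(m+2)`-angulation of the once-punctured polygon `P_n^•`: a set of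
pairwise noncrossing valid arcs, containing a spoke, all of whose finite faces are
`(m+2)`-gons, and all of whose faces at the puncture (those between consecutive
spoke lifts, with the puncture as one extra vertex) are `(m+2)`-gons. -/
def IsAngulation (n m : ℕ) (T : Finset (PArc n)) : Prop :=
  (∀ a ∈ T, PArc.Valid a) ∧
  (∀ a ∈ T, ∀ b ∈ T, a ≠ b → ¬ PArc.Cross a b) ∧
  (∃ s : Fin n, PArc.spoke s ∈ T) ∧
  (∀ S : Finset ℤ, IsFinFace T S → S.card = m + 2) ∧
  (∀ a b : ℤ, IsRay T a → IsRay T b → a < b → (∀ x : ℤ, a < x → x < b → ¬ IsRay T x) →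
    Nat.card {x : ℤ // a ≤ x ∧ x ≤ b ∧ ¬ Covered T x} = m + 1)

/-- The number of spokes of `T`. -/
def spokeCount {n : ℕ} (T : Finset (PArc n)) : ℕ := (T.filter (fun a => a.isSpoke)).card

/-- Counterclockwise rotation of arcs by `c` vertex positions (`v_i ↦ v_{i-c}`). -/
def rotArc {n : ℕ} (c : Fin n) : PArc n → PArc n
  | .spoke i => .spoke (i - c)
  | .per i j => .per (i - c) (j - c)


namespace PAng

/-- Edge relation of a chord family. -/
def Edge (C : ℤ → ℤ → Prop) (a b : ℤ) : Prop := b = a + 1 ∨ C a b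

/-- Finite faces of a chord family. -/
def FinFace (C : ℤ → ℤ → Prop) (S : Finset ℤ) : Prop :=
  3 ≤ S.card ∧
  (∀ u v : ℤ, ConsecIn S u v → Edge C u v) ∧
  (∃ a ∈ S, ∃ b ∈ S, (∀ x ∈ S, a ≤ x ∧ x ≤ b) ∧ C a b ∧
    ∀ u ∈ S, ∀ v ∈ S, u < v → C u v → (u = a ∧ v = b) ∨ ConsecIn S u v)

/-- Covered vertices of a chord family. -/
def Cov (C : ℤ → ℤ → Prop) (x : ℤ) : Prop := ∃ a b : ℤ, C a b ∧ a < x ∧ x < b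

/-- A periodic lifted angulation of the strip. -/
structure Lift (m N : ℕ) (C : ℤ → ℤ → Prop) (R : ℤ → Prop) : Prop where
  perC : ∀ a b, C a b ↔ C (a + N) (b + N)
  perR : ∀ a, R a ↔ R (a + N)
  lo : ∀ a b, C a b → a + 2 ≤ b
  hi : ∀ a b, C a b → b ≤ a + N
  nc : ∀ a b c d, C a b → C c d → a < c → c < b → b < d → False
  ray : ∀ a b x, R x → C a b → a < x → x < b → False
  ex : ∃ x, R x
  face : ∀ S, FinFace C S → S.card = m + 2
  rface : ∀ a b : ℤ, R a → R b → a < b → (∀ x : ℤ, a < x → x < b → ¬ R x) →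
    Nat.card {x : ℤ // a ≤ x ∧ x ≤ b ∧ ¬ Cov C x} = m + 1

/-- A height function with step counts `c` and drift `-D` per period. -/
structure Ht (m N : ℕ) (c : ℤ → ℕ) (h : ℤ → ℤ) (D : ℤ) : Prop where
  step : ∀ x, h (x + 1) = h x + m * c x - 1
  per : ∀ x, h (x + N) = h x - D
  pos : 0 < D

/-- Chords attached to a height function. -/
def CH (m : ℕ) (h : ℤ → ℤ) (a b : ℤ) : Prop :=
  a + 2 ≤ b ∧ (∃ j : ℕ, h b = h a - 1 + m * j) ∧ ∀ z, a < z → z < b → h b < h z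

/-- Strict record lows. -/
def RL (h : ℤ → ℤ) (x : ℤ) : Prop := ∀ y, y < x → h x < h y

/-- Rays attached to a height function. -/
def RH (m : ℕ) (h : ℤ → ℤ) (ρ : ℤ) (x : ℤ) : Prop := RL h x ∧ (m : ℤ) ∣ h x - ρ

lemma hit {h : ℤ → ℤ} (hs : ∀ x, h x - 1 ≤ h (x + 1)) {x y v : ℤ} (hxy : x ≤ y)
    (h1 : v ≤ h x) (h2 : h y ≤ v) :
    ∃ z, x ≤ z ∧ z ≤ y ∧ h z = v ∧ ∀ w, x ≤ w → w < z → v < h w := by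
  obtain ⟨z, ⟨hz1, hz2⟩, hz3⟩ := Int.exists_least_of_bdd (P := fun z => x ≤ z ∧ h z ≤ v)
    ⟨x, fun z hz => hz.1⟩ ⟨y, hxy, h2⟩
  have hlt : ∀ w, x ≤ w → w < z → v < h w := by
    intro w hw hwz
    by_contra hc
    have := hz3 w ⟨hw, by omega⟩
    omega
  refine ⟨z, hz1, hz3 y ⟨hxy, h2⟩, ?_, hlt⟩
  rcases eq_or_lt_of_le hz1 with e | e
  · subst e; omega
  · have h3 := hlt (z - 1) (by omega) (by omega)
    have h4 := hs (z - 1)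
    rw [sub_add_cancel] at h4
    omega

section ht
variable {m N : ℕ} {c : ℤ → ℕ} {h : ℤ → ℤ} {D : ℤ}

lemma Ht.step' (H : Ht m N c h D) (x : ℤ) : h x - 1 ≤ h (x + 1) := by
  have := H.step x
  have : (0 : ℤ) ≤ m * c x := by positivity
  omega

lemma step_ge (H : ∀ x, h (x + 1) = h x + m * c x - 1) (x : ℤ) : h x - 1 ≤ h (x + 1) := by
  have := H x
  have : (0 : ℤ) ≤ m * c x := by positivity
  omega

lemma Ht.per_mul (H : Ht m N c h D) (t : ℤ) (x : ℤ) : h (x + t * N) = h x - t * D := by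
  induction t using Int.induction_on with
  | zero => simp
  | succ i ih =>
    have := H.per (x + i * N)
    rw [show x + ((i : ℤ) + 1) * N = x + i * N + N by ring, this, ih]; ring
  | pred i ih =>
    have := H.per (x + (-(i : ℤ) - 1) * N)
    rw [show x + (-(i : ℤ) - 1) * N + N = x + -(i : ℤ) * N by ring, ih] at this
    linarith

lemma Ht.right (H : Ht m N c h D) (hN : 0 < N) (x v : ℤ) : ∃ y, x ≤ y ∧ h y ≤ v := by
  have hD := H.pos
  refine ⟨x + (|h x - v|) * N, ?_, ?_⟩
  · have : 0 ≤ |h x - v| * (N : ℤ) := by positivity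
    omega
  · rw [H.per_mul]
    have : h x - v ≤ |h x - v| := le_abs_self _
    have h0 : 0 ≤ |h x - v| := abs_nonneg _
    nlinarith

lemma Ht.left (H : Ht m N c h D) (hN : 0 < N) (v : ℤ) : ∃ B, ∀ x, x ≤ B → v < h x := by
  have hD := H.pos
  have hN' : (0 : ℤ) < N := by exact_mod_cast hN
  obtain ⟨M, hM⟩ : ∃ M, ∀ r ∈ Finset.Ico (0 : ℤ) N, M ≤ h r := by
    obtain ⟨M, hM⟩ := ((Finset.Ico (0 : ℤ) N).image h).bddBelow
    exact ⟨M, fun r hr => hM (by simpa using ⟨r, by simpa using hr, rfl⟩)⟩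
  refine ⟨-(|v - M| + 1) * N, fun x hx => ?_⟩
  have h1 := Int.emod_add_mul_ediv x N
  have h2 := Int.emod_nonneg x hN'.ne'
  have h3 := Int.emod_lt_of_pos x hN'
  have h4 := H.per_mul (x / N) (x % N)
  have h5 : x % N + x / N * N = x := by rw [mul_comm]; exact h1
  rw [h5] at h4
  have h6 := hM (x % N) (by simp [h2, h3])
  have h7 : x / N ≤ -(|v - M| + 1) := by
    by_contra hc
    have : -(|v - M| + 1) + 1 ≤ x / N := by omega
    nlinarith
  have h8 : v - M ≤ |v - M| := le_abs_self _
  have h0 : 0 ≤ |v - M| := abs_nonneg _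
  nlinarith

lemma CH_nc {a b c' d : ℤ} (h1 : CH m h a b) (h2 : CH m h c' d) (hac : a < c') (hcb : c' < b)
    (hbd : b < d) : False := by
  have e1 := h1.2.2 c' hac hcb
  have e2 := h2.2.2 b hcb hbd
  obtain ⟨j, hj⟩ := h2.2.1
  have : (0 : ℤ) ≤ m * j := by positivity
  omega

lemma Ht.CH_hi (H : Ht m N c h D) (hN : 0 < N) {a b : ℤ} (h1 : CH m h a b) : b ≤ a + N := by
  by_contra hc
  have e1 := h1.2.2 (a + N) (by omega) (by omega)
  obtain ⟨j, hj⟩ := h1.2.1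
  have : (0 : ℤ) ≤ m * j := by positivity
  have := H.per a
  have := H.pos
  omega

lemma Ht.CH_per (H : Ht m N c h D) (a b : ℤ) : CH m h a b ↔ CH m h (a + N) (b + N) := by
  unfold CH
  rw [H.per a, H.per b]
  refine and_congr (by omega) (and_congr (exists_congr fun j => by omega) ⟨?_, ?_⟩)
  · intro hh z hz1 hz2
    have := hh (z - N) (by omega) (by omega)
    have h3 := H.per (z - N)
    rw [sub_add_cancel] at h3
    omega
  · intro hh z hz1 hz2
    have := hh (z + N) (by omega) (by omega)
    have h3 := H.per z
    omega

lemma Ht.RL_per (H : Ht m N c h D) (x : ℤ) : RL h x ↔ RL h (x + N) := by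
  unfold RL
  rw [H.per x]
  refine ⟨?_, ?_⟩
  · intro hh z hz1
    have := hh (z - N) (by omega)
    have h3 := H.per (z - N)
    rw [sub_add_cancel] at h3
    omega
  · intro hh z hz1
    have := hh (z + N) (by omega)
    have h3 := H.per z
    omega

lemma RL_anti {x y : ℤ} (hx : RL h x) (hy : RL h y) : x < y ↔ h y < h x := by
  constructor
  · exact fun hxy => hy x hxy
  · intro hh
    by_contra hc
    rcases eq_or_lt_of_le (not_lt.1 hc) with e | e
    · subst e; omega
    · have := hx y e; omega

lemma RL_inj {x y : ℤ} (hx : RL h x) (hy : RL h y) (e : h x = h y) : x = y := by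
  have h1 := RL_anti hx hy
  have h2 := RL_anti hy hx
  omega

lemma RL_le {x y : ℤ} (hx : RL h x) (hy : RL h y) : x ≤ y ↔ h y ≤ h x := by
  have h2 := RL_anti hy hx
  omega

lemma Ht.rec_exists (H : Ht m N c h D) (hN : 0 < N) (v : ℤ) : ∃ x, RL h x ∧ h x = v := by
  obtain ⟨B, hB⟩ := H.left hN v
  obtain ⟨y, hy1, hy2⟩ := H.right hN B v
  obtain ⟨z, hz1, hz2, hz3, hz4⟩ := hit H.step' hy1 (hB B le_rfl).le hy2
  refine ⟨z, fun w hw => ?_, hz3⟩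
  rw [hz3]
  by_cases hwB : w ≤ B
  · exact hB w hwB
  · exact hz4 w (by omega) hw

lemma CH_exists (H : ∀ x, h (x + 1) = h x + m * c x - 1) (hm : 0 < m)
    (hR : ∀ x v, ∃ y, x ≤ y ∧ h y ≤ v) (a : ℤ) (j : ℕ) (hj : j < c a) :
    ∃ b, CH m h a b ∧ h b = h a - 1 + m * j := by
  have h1 := H a
  have h2 : (m : ℤ) * j < m * c a := by
    have : (j : ℤ) < c a := by exact_mod_cast hj
    have : (0 : ℤ) < m := by exact_mod_cast hm
    nlinarith
  obtain ⟨y, hy1, hy2⟩ := hR (a + 1) (h a - 1 + m * j)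
  obtain ⟨z, hz1, hz2, hz3, hz4⟩ := hit (step_ge H) hy1 (v := h a - 1 + m * j) (by omega) hy2
  refine ⟨z, ⟨?_, ⟨j, hz3⟩, ?_⟩, hz3⟩
  · rcases eq_or_lt_of_le hz1 with e | e
    · subst e; omega
    · omega
  · intro w hw1 hw2
    rw [hz3]; exact hz4 w (by omega) hw2

lemma CH_level (H : ∀ x, h (x + 1) = h x + m * c x - 1) {a b : ℤ}
    (hab : CH m h a b) : ∃ j < c a, h b = h a - 1 + m * (j : ℕ) := by
  obtain ⟨j, hj⟩ := hab.2.1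
  refine ⟨j, ?_, hj⟩
  have h1 := H a
  have h2 := hab.2.2 (a + 1) (by omega) (by have := hab.1; omega)
  have h3 : (m : ℤ) * j < m * c a := by omega
  have h4 : m * j < m * c a := by exact_mod_cast h3
  exact lt_of_mul_lt_mul_left h4 (Nat.zero_le _)

lemma CH_inj {a b b' : ℤ} (h1 : CH m h a b) (h2 : CH m h a b') (e : h b = h b') : b = b' := by
  rcases lt_trichotomy b b' with hh | hh | hh
  · have := h2.2.2 b (by have := h1.1; omega) hh; omega
  · exact hh
  · have := h1.2.2 b' (by have := h2.1; omega) hh; omega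

lemma CH_fin (H : ∀ x, h (x + 1) = h x + m * c x - 1) (a : ℤ) :
    {b | CH m h a b}.Finite ∧ {b | CH m h a b}.ncard ≤ c a := by
  have hmap : Set.MapsTo h {b | CH m h a b}
      (((Finset.range (c a)).image fun j : ℕ => h a - 1 + m * (j : ℤ) : Finset ℤ) : Set ℤ) := by
    intro b hb
    obtain ⟨j, hj, e⟩ := CH_level H hb
    simp only [Finset.coe_image, Set.mem_image, Finset.coe_range, Set.mem_Iio]
    exact ⟨j, hj, e.symm⟩
  have hinj : Set.InjOn h {b | CH m h a b} := fun b hb b' hb' e => CH_inj hb hb' e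
  refine ⟨Set.Finite.of_injOn hmap hinj (Finset.finite_toSet _), ?_⟩
  refine (Set.ncard_le_ncard_of_injOn h hmap hinj (Finset.finite_toSet _)).trans ?_
  rw [Set.ncard_coe_finset]
  exact Finset.card_image_le.trans (by simp)

lemma CH_card (H : ∀ x, h (x + 1) = h x + m * c x - 1) (hm : 0 < m)
    (hR : ∀ x v, ∃ y, x ≤ y ∧ h y ≤ v) (a : ℤ) :
    {b | CH m h a b}.ncard = c a := by
  refine le_antisymm (CH_fin H a).2 ?_
  choose! f hf using fun j hj => CH_exists H hm hR a j hj
  have : ((Finset.range (c a) : Finset ℕ) : Set ℕ).ncard ≤ {b | CH m h a b}.ncard := by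
    refine Set.ncard_le_ncard_of_injOn f ?_ ?_ (CH_fin H a).1
    · intro j hj
      exact (hf j (by simpa using hj)).1
    · intro j hj j' hj' e
      have e1 := (hf j (by simpa using hj)).2
      have e2 := (hf j' (by simpa using hj')).2
      rw [e] at e1
      have e3 : (m : ℤ) * j = m * j' := by omega
      have e4 : m * j = m * j' := by exact_mod_cast e3
      exact Nat.eq_of_mul_eq_mul_left hm e4
  simpa using this

lemma Ht.cov_iff (H : Ht m N c h D) (hN : 0 < N) (x : ℤ) : Cov (CH m h) x ↔ ¬ RL h x := by
  constructor
  · rintro ⟨a, b, hab, hax, hxb⟩ hrl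
    have h1 := hab.2.2 x hax hxb
    have h2 := hrl a hax
    obtain ⟨j, hj⟩ := hab.2.1
    have : (0 : ℤ) ≤ m * j := by positivity
    omega
  · intro hrl
    unfold RL at hrl
    push Not at hrl
    obtain ⟨a0, ha0, hle⟩ := hrl
    obtain ⟨a, ha, hmin⟩ := (Finset.Ico a0 x).exists_min_image h ⟨a0, by simp [ha0]⟩
    rw [Finset.mem_Ico] at ha
    have hax : h a ≤ h x := (hmin a0 (by simp [ha0])).trans hle
    have hge : ∀ z, a < z → z ≤ x → h a ≤ h z := by
      intro z hz1 hz2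
      rcases eq_or_lt_of_le hz2 with e | e
      · rw [e]; exact hax
      · exact hmin z (by rw [Finset.mem_Ico]; omega)
    obtain ⟨y, hy1, hy2⟩ := H.right hN x (h a - 1)
    obtain ⟨z, hz1, hz2, hz3, hz4⟩ := hit H.step' hy1 (v := h a - 1) (by omega) hy2
    have hzx : x < z := by
      rcases eq_or_lt_of_le hz1 with e | e
      · subst e; omega
      · exact e
    refine ⟨a, z, ⟨by omega, ⟨0, by simp [hz3]⟩, ?_⟩, ha.2, hzx⟩
    intro w hw1 hw2
    by_cases hwx : w ≤ x
    · have := hge w hw1 hwx; omega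
    · have := hz4 w (by omega) hw2; omega

lemma Ht.card_unc (H : Ht m N c h D) (hN : 0 < N) {a b : ℤ} (ha : RL h a) (hb : RL h b) :
    Nat.card {x : ℤ // a ≤ x ∧ x ≤ b ∧ ¬ Cov (CH m h) x} = (h a + 1 - h b).toNat := by
  rw [← Int.card_Icc, ← Nat.card_eq_finsetCard]
  refine Nat.card_congr (Equiv.ofBijective (fun x => ⟨h x.1, ?_⟩) ⟨?_, ?_⟩)
  · obtain ⟨x, h1, h2, h3⟩ := x
    rw [H.cov_iff hN, not_not] at h3
    simp only [Finset.mem_Icc]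
    exact ⟨(RL_le h3 hb).1 h2, (RL_le ha h3).1 h1⟩
  · rintro ⟨x, h1, h2, h3⟩ ⟨y, h4, h5, h6⟩ e
    rw [H.cov_iff hN, not_not] at h3 h6
    simp only [Subtype.mk.injEq] at e ⊢
    exact RL_inj h3 h6 e
  · rintro ⟨v, hv⟩
    simp only [Finset.mem_Icc] at hv
    obtain ⟨x, hx, rfl⟩ := H.rec_exists hN v
    exact ⟨⟨x, (RL_le ha hx).2 hv.2, (RL_le hx hb).2 hv.1, by rw [H.cov_iff hN, not_not]; exact hx⟩, rfl⟩

end ht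

lemma consec_around {S : Finset ℤ} {a b y : ℤ} (ha : a ∈ S) (hb : b ∈ S) (hay : a < y)
    (hyb : y < b) (hy : y ∉ S) :
    ∃ p q, ConsecIn S p q ∧ p < y ∧ y < q ∧ ∀ x ∈ S, x < y → x ≤ p := by
  obtain ⟨p, hp, hpm⟩ := (S.filter (· < y)).exists_max_image id ⟨a, by simp [ha, hay]⟩
  obtain ⟨q, hq, hqm⟩ := (S.filter (y < ·)).exists_min_image id ⟨b, by simp [hb, hyb]⟩
  simp only [Finset.mem_filter, id] at hp hq hpm hqm
  refine ⟨p, q, ⟨hp.1, hq.1, by omega, ?_⟩, hp.2, hq.2, fun x hx hxy => hpm x ⟨hx, hxy⟩⟩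
  rintro x hx ⟨h1, h2⟩
  rcases lt_trichotomy x y with e | e | e
  · have := hpm x ⟨hx, e⟩; omega
  · subst e; exact hy hx
  · have := hqm x ⟨hx, e⟩; omega

lemma enum (S : Finset ℤ) : ∃ v : ℕ → ℤ, (∀ i j, i < j → j < S.card → v i < v j) ∧
    ∀ x, x ∈ S ↔ ∃ i < S.card, v i = x := by
  refine ⟨fun i => if hi : i < S.card then S.orderEmbOfFin rfl ⟨i, hi⟩ else 0, ?_, ?_⟩
  · intro i j hij hj
    have hi : i < S.card := hij.trans hj
    simp only [hi, hj, dif_pos]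
    exact (S.orderEmbOfFin rfl).strictMono hij
  · intro x
    have : x ∈ S ↔ x ∈ Set.range (S.orderEmbOfFin rfl) := by
      rw [Finset.range_orderEmbOfFin]; rfl
    rw [this]
    constructor
    · rintro ⟨⟨i, hi⟩, rfl⟩
      exact ⟨i, hi, by simp [hi]⟩
    · rintro ⟨i, hi, rfl⟩
      exact ⟨⟨i, hi⟩, by simp [hi]⟩

lemma enum_consec {S : Finset ℤ} {v : ℕ → ℤ} (h1 : ∀ i j, i < j → j < S.card → v i < v j)
    (h2 : ∀ x, x ∈ S ↔ ∃ i < S.card, v i = x) {i : ℕ} (hi : i + 1 < S.card) :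
    ConsecIn S (v i) (v (i + 1)) := by
  refine ⟨(h2 _).2 ⟨i, by omega, rfl⟩, (h2 _).2 ⟨i + 1, hi, rfl⟩, h1 _ _ (by omega) hi, ?_⟩
  rintro x hx ⟨e1, e2⟩
  obtain ⟨j, hj, rfl⟩ := (h2 x).1 hx
  rcases Nat.lt_or_ge i j with h | h
  · rcases Nat.lt_or_ge j (i + 1) with h' | h'
    · omega
    · rcases Nat.eq_or_lt_of_le h' with h'' | h''
      · rw [h''] at e2; exact lt_irrefl _ e2
      · have := h1 _ _ h'' hj; omega
  · rcases Nat.eq_or_lt_of_le h with h'' | h''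
    · rw [h''] at e1; exact lt_irrefl _ e1
    · have := h1 _ _ h'' (by omega); omega

section ht2
variable {m N : ℕ} {c : ℤ → ℕ} {h : ℤ → ℤ} {D : ℤ}

lemma edge_CH (H : ∀ x, h (x + 1) = h x + m * c x - 1) {a b : ℤ} (he : Edge (CH m h) a b) :
    a < b ∧ (∃ j : ℕ, h b = h a - 1 + m * j) ∧ ∀ z, a < z → z < b → h b < h z := by
  rcases he with rfl | he
  · exact ⟨by omega, ⟨c a, by rw [H]; ring⟩, fun z h1 h2 => by omega⟩
  · exact ⟨by have := he.1; omega, he.2⟩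

lemma CH_face (H : ∀ x, h (x + 1) = h x + m * c x - 1) (S : Finset ℤ)
    (hS : FinFace (CH m h) S) : S.card = m + 2 := by
  obtain ⟨h3, hedge, a, haS, b, hbS, hmm, hab, hno⟩ := hS
  obtain ⟨v, hv1, hv2⟩ := enum S
  -- membership
  have inS : ∀ x y w, CH m h x y → x ∈ S → w ∈ S → x < w → w < y → y ≤ b → y ∈ S := by
    intro x y w hxy hx hw hxw hwy hyb
    by_contra hy
    have hyb' : y < b := lt_of_le_of_ne hyb (by rintro rfl; exact hy hbS)
    obtain ⟨p, q, hpq, h4, h5, h6⟩ := consec_around haS hbS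
      (y := y) (by have := (hmm x hx).1; omega) hyb' hy
    have h7 := h6 w hw hwy
    rcases hedge p q hpq with e | e
    · omega
    · exact CH_nc hxy e (by omega) h4 h5
  have hv0 : v 0 = a := by
    obtain ⟨i, hi, e⟩ := (hv2 a).1 haS
    rcases Nat.eq_zero_or_pos i with h0 | h0
    · rw [← e, h0]
    · have := hv1 0 i h0 hi
      have := (hmm (v 0) ((hv2 _).2 ⟨0, by omega, rfl⟩)).1
      omega
  obtain ⟨t, ht⟩ : ∃ t, S.card = t + 3 := ⟨S.card - 3, by omega⟩
  have hvt : v (t + 2) = b := by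
    obtain ⟨i, hi, e⟩ := (hv2 b).1 hbS
    rcases Nat.lt_or_ge i (t + 2) with h0 | h0
    · have := hv1 i (t + 2) h0 (by omega)
      have := (hmm (v (t + 2)) ((hv2 _).2 ⟨t + 2, by omega, rfl⟩)).2
      omega
    · rw [← e]; congr 1; omega
  have mem : ∀ i, i < t + 3 → v i ∈ S := fun i hi => (hv2 _).2 ⟨i, by omega, rfl⟩
  have hstep : ∀ i, 1 ≤ i → i + 1 < t + 3 → h (v (i + 1)) = h (v i) - 1 := by
    intro i hi1 hi2
    have hcon := enum_consec hv1 hv2 (i := i) (by omega)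
    obtain ⟨huw, ⟨j, hj⟩, hz⟩ := edge_CH H (hedge _ _ hcon)
    have hau : a < v i := by rw [← hv0]; exact hv1 0 i hi1 (by omega)
    have hub : v i < b := by rw [← hvt]; exact hv1 i _ (by omega) (by omega)
    have hwb : v (i + 1) ≤ b := (hmm _ (mem _ hi2)).2
    by_contra hne
    have hmj : (0 : ℤ) ≤ m * j := by positivity
    have hbu := hab.2.2 _ hau hub
    obtain ⟨y, hy1, hy2, hy3, hy4⟩ := hit (step_ge H) hwb (v := h (v i) - 1) (by omega) (by omega)
    have hyw : v (i + 1) < y := by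
      rcases eq_or_lt_of_le hy1 with e | e
      · rw [← e] at hy3; omega
      · exact e
    have hch : CH m h (v i) y := by
      refine ⟨by omega, ⟨0, by simp [hy3]⟩, fun z hz1 hz2 => ?_⟩
      by_cases hzw : z < v (i + 1)
      · have := hz z hz1 hzw; omega
      · have := hy4 z (by omega) hz2; omega
    have hyS := inS _ _ _ hch (mem i (by omega)) (mem _ hi2) huw hyw hy2
    rcases hno _ (mem i (by omega)) _ hyS (by omega) hch with e | e
    · omega
    · exact e.2.2.2 _ (mem _ hi2) ⟨huw, hyw⟩
  have hfirst : h b = h (v 1) - m := by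
    have hcon := enum_consec hv1 hv2 (i := 0) (by omega)
    obtain ⟨huw, ⟨j, hj⟩, hz⟩ := edge_CH H (hedge _ _ hcon)
    rw [zero_add, hv0] at huw hj hz
    have hub : v 1 < b := by rw [← hvt]; exact hv1 1 _ (by omega) (by omega)
    have hbu := hab.2.2 _ huw hub
    obtain ⟨j', hj'⟩ := hab.2.1
    have hjj : j' < j := by
      have h4 : (m : ℤ) * j' < m * j := by omega
      have h5 : m * j' < m * j := by exact_mod_cast h4
      exact lt_of_mul_lt_mul_left h5 (Nat.zero_le _)
    have hm : (0 : ℤ) < m := by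
      rcases Nat.eq_zero_or_pos m with e | e
      · subst e; simp at hj hj'; omega
      · exact_mod_cast e
    obtain ⟨k, rfl⟩ : ∃ k, j = j' + 1 + k := ⟨j - j' - 1, by omega⟩
    rcases Nat.eq_zero_or_pos k with hk | hk
    · subst hk; rw [hj', hj]; push_cast; ring
    · exfalso
      have hkm : (0 : ℤ) < m * k := by positivity
      push_cast at hj
      have hj2 : h (v 1) = h a - 1 + m * j' + m + m * k := by rw [hj]; ring
      obtain ⟨y, hy1, hy2, hy3, hy4⟩ := hit (step_ge H) hub.le
        (v := h a - 1 + m * j' + m) (by omega) (by omega)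
      have hyw : v 1 < y := by
        rcases eq_or_lt_of_le hy1 with e | e
        · rw [← e] at hy3; omega
        · exact e
      have hyb : y ≠ b := by rintro rfl; omega
      have hch : CH m h a y := by
        refine ⟨by omega, ⟨j' + 1, by rw [hy3]; push_cast; ring⟩, fun z hz1 hz2 => ?_⟩
        by_cases hzw : z < v 1
        · have := hz z hz1 hzw; omega
        · have := hy4 z (by omega) hz2; omega
      have hyS := inS _ _ _ hch haS (mem 1 (by omega)) huw hyw hy2
      rcases hno _ haS _ hyS (by omega) hch with e | e
      · exact hyb e.2
      · exact e.2.2.2 _ (mem 1 (by omega)) ⟨huw, hyw⟩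
  have hlin : ∀ i : ℕ, i + 1 < t + 3 → h (v (i + 1)) = h (v 1) - i := by
    intro i
    induction i with
    | zero => intro; simp
    | succ i ih =>
      intro hi
      rw [hstep (i + 1) (by omega) hi, ih (by omega)]; push_cast; ring
  have := hlin (t + 1) (by omega)
  rw [hvt, hfirst] at this
  push_cast at this
  omega

lemma Ht.lift (H : Ht m N c h D) (hm : 0 < m) (hN : 0 < N) (hD : (m : ℤ) ∣ D) (ρ : ℤ) :
    Lift m N (CH m h) (RH m h ρ) where
  perC := H.CH_per
  perR a := by
    unfold RH
    rw [← H.RL_per, H.per]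
    refine and_congr Iff.rfl ?_
    rw [show h a - D - ρ = h a - ρ - D by ring]
    exact (dvd_sub_left hD).symm
  lo a b hab := hab.1
  hi a b hab := H.CH_hi hN hab
  nc a b c d h1 h2 h3 h4 h5 := CH_nc h1 h2 h3 h4 h5
  ray a b x hx hab h1 h2 := (H.cov_iff hN x).1 ⟨a, b, hab, h1, h2⟩ hx.1
  ex := by
    obtain ⟨x, hx, e⟩ := H.rec_exists hN ρ
    exact ⟨x, hx, by simp [e]⟩
  face := CH_face H.step
  rface a b ha hb hab hno := by
    have hm' : (0 : ℤ) < m := by exact_mod_cast hm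
    rw [H.card_unc hN ha.1 hb.1]
    have h1 := (RL_anti ha.1 hb.1).1 hab
    have hdv : (m : ℤ) ∣ h a - h b := by
      have := dvd_sub ha.2 hb.2
      rwa [show h a - ρ - (h b - ρ) = h a - h b by ring] at this
    have h2 := Int.le_of_dvd (by omega) hdv
    obtain ⟨x, hx, e⟩ := H.rec_exists hN (h a - m)
    have hxR : RH m h ρ x := by
      refine ⟨hx, ?_⟩
      rw [e, show h a - m - ρ = h a - ρ - m by ring]
      exact dvd_sub ha.2 (dvd_refl _)
    have h3 := hno x ((RL_anti ha.1 hx).2 (by omega))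
    have h4 : h b = h a - m := by
      by_contra hne
      exact h3 ((RL_anti hx hb.1).2 (by omega)) hxR
    rw [h4]; omega

open Classical in
lemma Ht.ray_count (H : Ht m N c h D) (hm : 0 < m) (hN : 0 < N) (ρ : ℤ) (p q : ℕ)
    (hper : ∀ x, h (x + p) = h x - m * q) (hRL : ∀ x, RL h x ↔ RL h (x + p)) :
    ((Finset.Ico (0 : ℤ) p).filter (fun x => RH m h ρ x)).card = q := by
  have hm' : (0 : ℤ) < m := by exact_mod_cast hm
  obtain ⟨x0, ⟨hx1, hx2⟩, hx3⟩ := Int.exists_least_of_bdd (P := fun x => 0 ≤ x ∧ RL h x)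
    ⟨0, fun z hz => hz.1⟩ (by
      obtain ⟨x, hx, e⟩ := H.rec_exists hN (h 0)
      obtain ⟨B, hB⟩ := H.left hN (h 0)
      obtain ⟨y, hy1, hy2⟩ := H.rec_exists hN (min (h 0) (Finset.inf' (Finset.Icc (-|B|) 0) (by simp) h) - 1)
      refine ⟨y, ?_, hy1⟩
      by_contra hc
      by_cases hyB : y ≤ B
      · have := hB y hyB; omega
      · have : (Finset.inf' (Finset.Icc (-|B|) 0) (by simp) h) ≤ h y := Finset.inf'_le _ (by
          rw [Finset.mem_Icc]; have := neg_abs_le B; omega)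
        omega)
  have hx2' := (hRL x0).1 hx2
  have key : ((Finset.Ico (0 : ℤ) p).filter (fun x => RH m h ρ x)).card =
      ((Finset.Ioc (h x0 - m * q) (h x0)).filter (fun v => v ≡ ρ [ZMOD m])).card := by
    refine Finset.card_bij (fun x _ => h x) ?_ ?_ ?_
    · intro x hx
      simp only [Finset.mem_filter, Finset.mem_Ico, Finset.mem_Ioc] at hx ⊢
      obtain ⟨⟨a1, a2⟩, a3, a4⟩ := hx
      refine ⟨⟨?_, (RL_le hx2 a3).1 (hx3 x ⟨a1, a3⟩)⟩, ?_⟩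
      · rw [← hper]
        exact (RL_anti a3 hx2').1 (by omega)
      · exact (Int.modEq_iff_dvd.2 a4).symm
    · intro x hx y hy e
      simp only [Finset.mem_filter] at hx hy
      exact RL_inj hx.2.1 hy.2.1 e
    · intro v hv
      simp only [Finset.mem_filter, Finset.mem_Ioc] at hv
      obtain ⟨x, hx, e⟩ := H.rec_exists hN v
      refine ⟨x, ?_, e⟩
      simp only [Finset.mem_filter, Finset.mem_Ico]
      refine ⟨⟨?_, ?_⟩, hx, ?_⟩
      · have := (RL_le hx2 hx).2 (by omega); omega
      · have h1 := (RL_anti hx hx2').2 (by rw [hper]; omega)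
        by_contra hc
        have h2 := (hRL (x - p)).2 (by simpa using hx)
        have := hx3 (x - p) ⟨by omega, h2⟩
        omega
      · rw [e]; exact Int.modEq_iff_dvd.1 hv.2.symm
  rw [key]
  have := Int.Ioc_filter_modEq_card (h x0 - m * q) (h x0) hm' ρ
  have hmq : (m : ℚ) ≠ 0 := by positivity
  have e2 : (((h x0 - m * q : ℤ) : ℚ) - ρ) / ((m : ℤ) : ℚ) = ((h x0 : ℚ) - ρ) / ((m : ℤ) : ℚ) - (q : ℕ) := by
    push_cast
    field_simp
    ring
  rw [e2, Int.floor_sub_natCast] at this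
  have h5 : (0 : ℤ) ≤ q := by positivity
  rw [sub_sub_cancel, max_eq_left h5] at this
  exact_mod_cast this

end ht2

section lf
variable {m N : ℕ} {C : ℤ → ℤ → Prop} {R : ℤ → Prop}

lemma Lift.finC (F : Lift m N C R) (a : ℤ) : {b | C a b}.Finite :=
  (Set.finite_Icc (a + 2) (a + N)).subset fun b hb => ⟨F.lo a b hb, F.hi a b hb⟩

lemma Lift.maxE (F : Lift m N C R) (hN : 0 < N) (x : ℤ) :
    ∃ e, Edge C x e ∧ ∀ e', Edge C x e' → e' ≤ e :=
  Int.exists_greatest_of_bdd ⟨x + N, fun z hz => by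
    rcases hz with rfl | hz
    · omega
    · exact F.hi _ _ hz⟩ ⟨x + 1, Or.inl rfl⟩

lemma Lift.edge_lt (F : Lift m N C R) {a b : ℤ} (h : Edge C a b) : a < b := by
  rcases h with rfl | h
  · omega
  · have := F.lo _ _ h; omega

lemma Lift.below (F : Lift m N C R) {a b x e : ℤ} (hab : C a b) (hax : a < x) (hxb : x < b)
    (he : Edge C x e) : e ≤ b := by
  rcases he with rfl | he
  · omega
  · by_contra hc
    exact F.nc a b x e hab he hax hxb (by omega)

/-- The number of chords from `a` of length at most that of `(a,b)`. -/
noncomputable def cnt (C : ℤ → ℤ → Prop) (a b : ℤ) : ℕ := {b' | C a b' ∧ b' ≤ b}.ncard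

lemma Lift.face_seq (F : Lift m N C R) {E : ℤ → ℤ}
    (hE1 : ∀ x, Edge C x (E x)) (hE2 : ∀ x e, Edge C x e → e ≤ E x) {a b : ℤ} (hab : C a b) :
    ∃ g : ℕ → ℤ, StrictMono g ∧ Edge C a (g 0) ∧ g 0 < b ∧ (∀ e, Edge C a e → e < b → e ≤ g 0) ∧
      (∀ i, g (i + 1) = E (g i)) ∧ g m = b := by
  have hlo := F.lo a b hab
  obtain ⟨v, ⟨hv1, hv2⟩, hv3⟩ := Int.exists_greatest_of_bdd (P := fun e => Edge C a e ∧ e < b)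
    ⟨b, fun z hz => hz.2.le⟩ ⟨a + 1, Or.inl rfl, by omega⟩
  let g : ℕ → ℤ := fun i => E^[i] v
  have g0 : g 0 = v := rfl
  have gs : ∀ i, g (i + 1) = E (g i) := fun i => Function.iterate_succ_apply' E i v
  have gm : StrictMono g := strictMono_nat_of_lt_succ fun i => by
    rw [gs]; exact F.edge_lt (hE1 _)
  refine ⟨g, gm, hv1, hv2, fun e h1 h2 => hv3 e ⟨h1, h2⟩, gs, ?_⟩
  have hav : a < v := F.edge_lt hv1
  have hbig : ∃ i, b ≤ g i := by
    have : ∀ i : ℕ, v + i ≤ g i := by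
      intro i
      induction i with
      | zero => simp [g0]
      | succ i ih => have := gm (Nat.lt_succ_self i); push_cast; simp only [Nat.succ_eq_add_one] at this; omega
    refine ⟨(b - v).toNat, ?_⟩
    have := this (b - v).toNat
    omega
  classical
  obtain ⟨τ, hτ, hmin⟩ : ∃ τ, b ≤ g τ ∧ ∀ i < τ, g i < b :=
    ⟨Nat.find hbig, Nat.find_spec hbig, fun i hi => by simpa using Nat.find_min hbig hi⟩
  have hτ0 : 0 < τ := by
    rcases Nat.eq_zero_or_pos τ with e | e
    · subst e; rw [g0] at hτ; omega
    · exact e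
  have hag : ∀ i, a < g i := fun i => lt_of_lt_of_le hav (gm.monotone (Nat.zero_le i))
  have hτb : g τ = b := by
    obtain ⟨k, rfl⟩ : ∃ k, τ = k + 1 := ⟨τ - 1, by omega⟩
    have h1 := F.below hab (hag k) (hmin k (by omega)) (hE1 (g k))
    rw [← gs] at h1
    omega
  have hface : FinFace C (insert a ((Finset.range (τ + 1)).image g)) := by
    have hcard : (insert a ((Finset.range (τ + 1)).image g)).card = τ + 2 := by
      rw [Finset.card_insert_of_notMem, Finset.card_image_of_injective _ gm.injective,
        Finset.card_range]
      intro hc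
      obtain ⟨i, -, e⟩ := Finset.mem_image.1 hc
      have := hag i
      omega
    have mem : ∀ x, x ∈ insert a ((Finset.range (τ + 1)).image g) ↔
        x = a ∨ ∃ i ≤ τ, g i = x := by
      intro x
      simp
    have bd : ∀ i ≤ τ, g i ≤ b := fun i hi => hτb ▸ gm.monotone hi
    refine ⟨by omega, ?_, a, (mem a).2 (Or.inl rfl), b, (mem b).2 (Or.inr ⟨τ, le_rfl, hτb⟩),
      ?_, hab, ?_⟩
    · rintro u w ⟨hu, hw, huw, hno⟩
      rw [mem] at hu hw
      rcases hw with rfl | ⟨j, hj, rfl⟩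
      · rcases hu with rfl | ⟨i, hi, rfl⟩
        · omega
        · have := hag i; omega
      · rcases hu with rfl | ⟨i, hi, rfl⟩
        · rcases Nat.eq_zero_or_pos j with e | e
          · subst e; exact hv1
          · exact absurd ⟨hag 0, gm e⟩ (hno (g 0) ((mem _).2 (Or.inr ⟨0, by omega, rfl⟩)))
        · have hij := gm.lt_iff_lt.1 huw
          rcases Nat.eq_or_lt_of_le (Nat.succ_le_of_lt hij) with e | e
          · rw [← e, Nat.succ_eq_add_one, gs]; exact hE1 _
          · exact absurd ⟨gm (Nat.lt_succ_self i), gm e⟩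
              (hno (g (i + 1)) ((mem _).2 (Or.inr ⟨i + 1, by omega, rfl⟩)))
    · intro x hx
      rcases (mem x).1 hx with rfl | ⟨i, hi, rfl⟩
      · omega
      · exact ⟨(hag i).le, bd i hi⟩
    · intro u hu w hw huw hC
      have hu' := (mem u).1 hu
      have hw' := (mem w).1 hw
      rcases hw' with rfl | ⟨j, hj, rfl⟩
      · rcases hu' with rfl | ⟨i, hi, rfl⟩
        · omega
        · have := hag i; omega
      · rcases hu' with rfl | ⟨i, hi, rfl⟩
        · rcases Nat.eq_or_lt_of_le hj with e | e
          · left; exact ⟨rfl, by rw [e, hτb]⟩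
          · right
            have h1 := hv3 (g j) ⟨Or.inr hC, hmin j e⟩
            rw [← g0] at h1
            have hj0 : j = 0 := by have := gm.le_iff_le.1 h1; omega
            subst hj0
            refine ⟨hu, hw, huw, ?_⟩
            rintro x hx ⟨e1, e2⟩
            rcases (mem x).1 hx with rfl | ⟨i, hi, rfl⟩
            · omega
            · have := gm.lt_iff_lt.1 e2; omega
        · right
          have h1 := hE2 (g i) (g j) (Or.inr hC)
          rw [← gs] at h1
          have h2 := gm.le_iff_le.1 h1
          have h3 := gm.lt_iff_lt.1 huw
          have h4 : j = i + 1 := by omega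
          subst h4
          refine ⟨hu, hw, huw, ?_⟩
          rintro x hx ⟨e1, e2⟩
          rcases (mem x).1 hx with rfl | ⟨k, hk, rfl⟩
          · have := hag i; omega
          · have := gm.lt_iff_lt.1 e2
            have := gm.lt_iff_lt.1 e1
            omega
  have h5 := F.face _ hface
  rw [Finset.card_insert_of_notMem, Finset.card_image_of_injective _ gm.injective,
        Finset.card_range] at h5
  · rw [← hτb]; congr 1; omega
  · intro hc
    obtain ⟨i, -, e⟩ := Finset.mem_image.1 hc
    have := hag i
    omega

lemma Lift.edge_prop (F : Lift m N C R) (hN : 0 < N) {c : ℤ → ℕ} {h : ℤ → ℤ}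
    (hc : ∀ a, c a = {b | C a b}.ncard)
    (H : ∀ x, h (x + 1) = h x + m * c x - 1) : ∀ (k : ℕ) (a b : ℤ), b - a ≤ k → Edge C a b →
    (∀ z, a < z → z < b → h b < h z) ∧ h b + m * cnt C a b = h a - 1 + m * c a := by
  choose E hE1 hE2 using F.maxE hN
  intro k
  induction k with
  | zero => intro a b hk he; have := F.edge_lt he; omega
  | succ k ih =>
    intro a b hk he
    rcases he with rfl | hab
    · refine ⟨fun z _ _ => by omega, ?_⟩
      have : cnt C a (a + 1) = 0 := by
        unfold cnt
        rw [show {b' | C a b' ∧ b' ≤ a + 1} = ∅ from ?_, Set.ncard_empty]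
        ext x
        simp only [Set.mem_ofPred_eq, Set.mem_empty_iff_false, iff_false, not_and]
        intro hx; have := F.lo _ _ hx; omega
      rw [this, H]; push_cast; ring
    · obtain ⟨g, gm, g0, g0b, gmax, gs, gb⟩ := F.face_seq hE1 hE2 hab
      have hag0 := F.edge_lt g0
      have hag : ∀ i, a < g i := fun i => lt_of_lt_of_le hag0 (gm.monotone (Nat.zero_le i))
      have hfirst := ih a (g 0) (by push_cast at hk; omega) g0
      have hcntE : ∀ x, cnt C x (E x) = c x := by
        intro x
        rw [hc]; unfold cnt; congr 1; ext y
        simp only [Set.mem_ofPred_eq, and_iff_left_iff_imp]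
        exact fun hy => hE2 x y (Or.inr hy)
      have hst : ∀ i < m, (∀ z, g i < z → z < g (i + 1) → h (g (i + 1)) < h z) ∧
          h (g (i + 1)) = h (g i) - 1 := by
        intro i hi
        have hle : g (i + 1) ≤ b := gb ▸ gm.monotone (by omega : i + 1 ≤ m)
        have h1 := ih (g i) (g (i + 1)) (by have := hag i; push_cast at hk; omega)
          (by rw [gs]; exact hE1 _)
        refine ⟨h1.1, ?_⟩
        have h2 := h1.2
        rw [gs, hcntE] at h2
        rw [gs]; omega
      have hlin : ∀ i ≤ m, h (g i) = h (g 0) - i := by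
        intro i
        induction i with
        | zero => intro; simp
        | succ i ih' =>
          intro hi
          rw [(hst i (by omega)).2, ih' (by omega)]; push_cast; ring
      have hb : h b = h (g 0) - m := by rw [← hlin m le_rfl, gb]
      constructor
      · intro z hz1 hz2
        by_cases hz : z < g 0
        · have := hfirst.1 z hz1 hz; omega
        · have hz' : g 0 ≤ z := by omega
          have : ∀ j ≤ m, z < g j → h b < h z := by
            intro j
            induction j with
            | zero => intro _ h0; omega
            | succ j ihj =>
              intro hj hzj
              by_cases hzz : z < g j
              · exact ihj (by omega) hzz
              · rcases eq_or_lt_of_le (not_lt.1 hzz) with e | e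
                · rw [← e, hlin j (by omega), hb]; omega
                · have h1 := (hst j (by omega)).1 z e hzj
                  rw [hlin (j + 1) hj] at h1
                  push_cast at h1
                  omega
          exact this m le_rfl (by rw [gb]; exact hz2)
      · have hcnt : cnt C a b = cnt C a (g 0) + 1 := by
          unfold cnt
          rw [← Set.ncard_insert_of_notMem (a := b) (hs := (F.finC a).subset fun y hy => hy.1)]
          · congr 1
            ext y
            simp only [Set.mem_ofPred_eq, Set.mem_insert_iff]
            constructor
            · rintro ⟨h1, h2⟩
              rcases eq_or_lt_of_le h2 with e | e
              · exact Or.inl e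
              · exact Or.inr ⟨h1, gmax y (Or.inr h1) e⟩
            · rintro (rfl | ⟨h1, h2⟩)
              · exact ⟨hab, le_rfl⟩
              · exact ⟨h1, by omega⟩
          · simp only [Set.mem_ofPred_eq, not_and, not_le]; intro; exact g0b
        rw [hcnt, hb, ← hfirst.2]; push_cast; ring

lemma Lift.eq_CH (F : Lift m N C R) (hN : 0 < N) {c : ℤ → ℕ} {h : ℤ → ℤ}
    (hc : ∀ a, c a = {b | C a b}.ncard)
    (H : ∀ x, h (x + 1) = h x + m * c x - 1) : C = CH m h := by
  have hsub : ∀ a, {b | C a b} ⊆ {b | CH m h a b} := by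
    intro a b hab
    simp only [Set.mem_ofPred_eq] at hab ⊢
    have hlo := F.lo a b hab
    obtain ⟨h1, h2⟩ := F.edge_prop hN hc H (b - a).toNat a b (by omega) (Or.inr hab)
    refine ⟨hlo, ⟨c a - cnt C a b, ?_⟩, h1⟩
    have : cnt C a b ≤ c a := by
      rw [hc]; exact Set.ncard_le_ncard (fun y hy => hy.1) (F.finC a)
    rw [Nat.cast_sub this, mul_sub]
    omega
  ext a b
  have := Set.eq_of_subset_of_ncard_le (hsub a) ((CH_fin H a).2.trans (hc a).le) (CH_fin H a).1
  exact Set.ext_iff.1 this b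

lemma Lift.drift (F : Lift m N C R) (hN : 0 < N) {c : ℤ → ℕ} {h : ℤ → ℤ}
    (hc : ∀ a, c a = {b | C a b}.ncard)
    (H : ∀ x, h (x + 1) = h x + m * c x - 1) (y : ℤ) (hy : R y) :
    ∀ (k : ℕ) (x : ℤ), y - x ≤ k → x < y → h y < h x := by
  intro k
  induction k with
  | zero => intro x h1 h2; omega
  | succ k ih =>
    intro x h1 h2
    obtain ⟨e, he1, he2⟩ := F.maxE hN x
    have hlt := F.edge_lt he1
    obtain ⟨-, h3⟩ := F.edge_prop hN hc H (e - x).toNat x e (by omega) he1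
    have hcnt : cnt C x e = c x := by
      rw [hc]; unfold cnt; congr 1; ext y
      simp only [Set.mem_ofPred_eq, and_iff_left_iff_imp]
      exact fun hy => he2 y (Or.inr hy)
    rw [hcnt] at h3
    have hey : e ≤ y := by
      rcases he1 with rfl | he1
      · omega
      · by_contra hcc
        exact F.ray x e y hy he1 h2 (by omega)
    rcases eq_or_lt_of_le hey with e' | e'
    · subst e'; omega
    · have := ih e (by push_cast at h1; omega) e'
      omega

lemma Lift.cper (F : Lift m N C R) (a : ℤ) : {b | C (a + N) b}.ncard = {b | C a b}.ncard := by
  have : {b | C (a + N) b} = (fun b => b + (N : ℤ)) '' {b | C a b} := by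
    ext b
    simp only [Set.mem_ofPred_eq, Set.mem_image]
    constructor
    · intro hb
      exact ⟨b - N, (F.perC _ _).2 (by simpa using hb), by ring⟩
    · rintro ⟨b', hb', rfl⟩
      exact (F.perC _ _).1 hb'
  rw [this, Set.ncard_image_of_injective _ (add_left_injective _)]

lemma Lift.ht (F : Lift m N C R) (hN : 0 < N) {c : ℤ → ℕ} {h : ℤ → ℤ} {D : ℤ}
    (hc : ∀ a, c a = {b | C a b}.ncard)
    (H : ∀ x, h (x + 1) = h x + m * c x - 1) (hper : ∀ x, h (x + N) = h x - D) :
    Ht m N c h D := by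
  refine ⟨H, hper, ?_⟩
  obtain ⟨r, hr⟩ := F.ex
  have := F.drift hN hc H (r + N) ((F.perR r).1 hr) N r (by omega) (by omega)
  have := hper r
  omega

lemma Lift.perR_mul (F : Lift m N C R) (t : ℤ) (x : ℤ) : R x ↔ R (x + t * N) := by
  induction t using Int.induction_on with
  | zero => simp
  | succ i ih =>
    rw [ih, F.perR]; ring_nf
  | pred i ih =>
    rw [ih, F.perR (x + (-(i : ℤ) - 1) * N)]; ring_nf

lemma Lift.perC_mul (F : Lift m N C R) (t : ℤ) (x y : ℤ) :
    C x y ↔ C (x + t * N) (y + t * N) := by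
  induction t using Int.induction_on with
  | zero => simp
  | succ i ih =>
    rw [ih, F.perC]; ring_nf
  | pred i ih =>
    rw [ih, F.perC (x + (-(i : ℤ) - 1) * N)]; ring_nf

lemma Lift.eq_RH (F : Lift m N C R) (hm : 0 < m) (hN : 0 < N) {c : ℤ → ℕ} {h : ℤ → ℤ} {D : ℤ}
    (H : Ht m N c h D) (hC : C = CH m h) (hD : (m : ℤ) ∣ D) {r : ℤ} (hr : R r) :
    R = RH m h (h r) := by
  subst hC
  have hm' : (0 : ℤ) < m := by exact_mod_cast hm
  have rl : ∀ x, R x → RL h x := by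
    intro x hx
    by_contra hc
    obtain ⟨a, b, hab, h1, h2⟩ := (H.cov_iff hN x).2 hc
    exact F.ray a b x hx hab h1 h2
  -- the next ray
  have next : ∀ a, R a → ∃ b, R b ∧ h b = h a - m ∧ ∀ x, R x → h x < h a → h x ≤ h b := by
    intro a ha
    obtain ⟨b, ⟨hb1, hb2⟩, hb3⟩ := Int.exists_least_of_bdd (P := fun x => a < x ∧ R x)
      ⟨a, fun z hz => hz.1.le⟩ ⟨a + N, by omega, (F.perR a).1 ha⟩
    have h1 := F.rface a b ha hb2 hb1 (fun x e1 e2 hx => by have := hb3 x ⟨e1, hx⟩; omega)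
    rw [H.card_unc hN (rl a ha) (rl b hb2)] at h1
    refine ⟨b, hb2, by omega, fun x hx hlt => ?_⟩
    exact (RL_le (rl b hb2) (rl x hx)).1 (hb3 x ⟨(RL_anti (rl a ha) (rl x hx)).2 hlt, hx⟩)
  have down : ∀ (t : ℕ) (a : ℤ), R a → ∃ b, R b ∧ h b = h a - m * t := by
    intro t
    induction t with
    | zero => intro a ha; exact ⟨a, ha, by simp⟩
    | succ t ih =>
      intro a ha
      obtain ⟨b, hb, e⟩ := ih a ha
      obtain ⟨b', hb', e', -⟩ := next b hb
      exact ⟨b', hb', by rw [e', e]; push_cast; ring⟩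
  have cong : ∀ a x, R a → R x → h x ≤ h a → (m : ℤ) ∣ h x - h a := by
    intro a x ha hx hle
    obtain ⟨b, hb, e⟩ := down ((h a - h x) / m).toNat a ha
    have hq : 0 ≤ (h a - h x) / m := Int.ediv_nonneg (by omega) hm'.le
    rw [Int.toNat_of_nonneg hq] at e
    have h1 := Int.emod_add_mul_ediv (h a - h x) m
    have h2 := Int.emod_nonneg (h a - h x) hm'.ne'
    have h3 := Int.emod_lt_of_pos (h a - h x) hm'
    obtain ⟨b', hb', e', hn⟩ := next b hb
    have : h x = h b := by
      by_contra hne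
      have := hn x hx (by omega)
      omega
    exact ⟨-((h a - h x) / m), by rw [mul_neg]; omega⟩
  ext x
  constructor
  · intro hx
    refine ⟨rl x hx, ?_⟩
    rcases le_total (h x) (h r) with e | e
    · exact cong r x hr hx e
    · have := cong x r hx hr e
      rw [← neg_sub]; exact (dvd_neg).2 this
  · rintro ⟨hx, hdv⟩
    have hDp := H.pos
    -- a ray that is higher up than `x`
    have hr' := (F.perR_mul (-|h x - h r|) r).1 hr
    have e1 := H.per_mul (-|h x - h r|) r
    set r' := r + -|h x - h r| * N
    have hle : h x ≤ h r' := by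
      have h1 := le_abs_self (h x - h r)
      have h0 := abs_nonneg (h x - h r)
      rw [e1]; nlinarith
    have hdv' : (m : ℤ) ∣ h r' - h x := by
      have : h r' - h x = -(h x - h r) + |h x - h r| * D := by rw [e1]; ring
      rw [this]
      exact dvd_add ((dvd_neg).2 hdv) (hD.mul_left _)
    obtain ⟨k, hk⟩ := hdv'
    have hk0 : 0 ≤ k := by
      by_contra hc
      have : m * k < 0 := mul_neg_of_pos_of_neg hm' (by omega)
      omega
    obtain ⟨b, hb, e⟩ := down k.toNat r' hr'
    rw [Int.toNat_of_nonneg hk0] at e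
    have : x = b := RL_inj hx (rl b hb) (by omega)
    rw [this]; exact hb

end lf

section arcs
variable {n : ℕ}

lemma uniq {n x y t : ℤ} (h1 : x - y < n) (h2 : y - x < n) (h : x - y = t * n) : x = y := by
  have := Int.eq_zero_of_abs_lt_dvd (m := n) (x := x - y) ⟨t, by rw [h, mul_comm]⟩
    (abs_lt.2 ⟨by omega, h1⟩)
  omega

lemma gp_spec (i j : Fin n) : PArc.gp n i j < n ∧
    ∃ t : ℤ, (i.val : ℤ) + PArc.gp n i j = j.val + t * n := by
  have hi := i.2
  have hj := j.2
  unfold PArc.gp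
  rcases Nat.lt_or_ge j.val i.val with h | h
  · rw [Nat.mod_eq_of_lt (by omega)]
    exact ⟨by omega, 1, by push_cast [show i.val ≤ j.val + n by omega]; ring⟩
  · rw [show j.val + n - i.val = (j.val - i.val) + n by omega, Nat.add_mod_right,
      Nat.mod_eq_of_lt (by omega)]
    exact ⟨by omega, 0, by push_cast [h]; ring⟩

lemma len_spec (i j : Fin n) : 1 ≤ PArc.len n i j ∧ PArc.len n i j ≤ n ∧
    ∃ t : ℤ, (i.val : ℤ) + PArc.len n i j = j.val + t * n := by
  have hi := i.2
  unfold PArc.len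
  split_ifs with h
  · subst h; exact ⟨by omega, le_rfl, 1, by ring⟩
  · obtain ⟨h1, t, h2⟩ := gp_spec i j
    unfold PArc.gp at h1 h2
    refine ⟨?_, h1.le, t, h2⟩
    rcases Nat.eq_zero_or_pos ((j.val + n - i.val) % n) with e | e
    · rw [e] at h2
      have hj := j.2
      have := uniq (n := n) (x := i.val) (y := j.val) (t := t) (by omega) (by omega)
        (by push_cast at h2; linarith)
      exact absurd (Fin.ext (by exact_mod_cast this)) h
    · exact e

lemma len_eq {i j : Fin n} {l t : ℤ} (h1 : 1 ≤ l) (h2 : l ≤ n) (h : (i.val : ℤ) + l = j.val + t * n) :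
    (PArc.len n i j : ℤ) = l := by
  obtain ⟨h3, h4, t', h5⟩ := len_spec i j
  refine uniq (n := n) (t := t' - t) (by omega) (by omega) ?_
  rw [sub_mul]; omega

lemma gp_eq {i j : Fin n} {l t : ℤ} (h1 : 0 ≤ l) (h2 : l < n) (h : (i.val : ℤ) + l = j.val + t * n) :
    (PArc.gp n i j : ℤ) = l := by
  obtain ⟨h4, t', h5⟩ := gp_spec i j
  refine uniq (n := n) (t := t' - t) (by omega) (by omega) ?_
  rw [sub_mul]; omega

lemma repr_fin (hn : 0 < n) (a : ℤ) : ∃ i : Fin n, ∃ t : ℤ, a = (i.val : ℤ) + t * n := by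
  have hn' : (0 : ℤ) < n := by exact_mod_cast hn
  have h1 := Int.emod_add_mul_ediv a n
  have h2 := Int.emod_nonneg a hn'.ne'
  have h3 := Int.emod_lt_of_pos a hn'
  refine ⟨⟨(a % n).toNat, by omega⟩, a / n, ?_⟩
  rw [Int.toNat_of_nonneg h2, mul_comm]; exact h1.symm

lemma fin_eq {i j : Fin n} {t u : ℤ} (h : (i.val : ℤ) + t * n = j.val + u * n) : i = j ∧ t = u := by
  have hi := i.2
  have hj := j.2
  have h1 := uniq (n := n) (x := i.val) (y := j.val) (t := u - t) (by omega) (by omega)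
    (by rw [sub_mul]; omega)
  refine ⟨Fin.ext (by exact_mod_cast h1), ?_⟩
  have h2 : t * (n : ℤ) = u * n := by omega
  exact mul_right_cancel₀ (by omega) h2

lemma sub_spec {N : ℕ} (i c : Fin n) (hc : c.val = N % n) :
    ∃ t : ℤ, ((i - c : Fin n).val : ℤ) = i.val - N + t * n := by
  have hcn := c.2
  have h0 : ((i - c : Fin n).val) = (n - c.val + i.val) % n := by rw [Fin.sub_def]
  rw [h0]
  have h1 := Nat.mod_add_div (n - c.val + i.val) n
  have h2 := Nat.mod_add_div N n
  rw [← hc] at h2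
  zify [hcn.le] at h1 h2
  refine ⟨1 + (N : ℤ) / n - ((n : ℤ) - c.val + i.val) / n, ?_⟩
  push_cast [hcn.le]
  linear_combination h1 - h2

lemma mem_chord {T : Finset (PArc n)} (i j : Fin n) :
    PArc.per i j ∈ T ↔ IsChord T i.val (i.val + PArc.len n i j) := by
  constructor
  · intro h
    exact ⟨i, j, h, 0, by ring, rfl⟩
  · rintro ⟨i', j', h, t, h1, h2⟩
    obtain ⟨rfl, rfl⟩ := fin_eq (i := i) (j := i') (t := 0) (u := t) (by simpa using h1)
    obtain ⟨-, -, u, hu⟩ := len_spec i j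
    obtain ⟨-, -, u', hu'⟩ := len_spec i j'
    obtain ⟨rfl, -⟩ := fin_eq (i := j) (j := j') (t := u) (u := u') (by omega)
    exact h

lemma mem_ray {T : Finset (PArc n)} (i : Fin n) : PArc.spoke i ∈ T ↔ IsRay T i.val := by
  constructor
  · intro h
    exact ⟨i, h, 0, by ring⟩
  · rintro ⟨i', h, t, h1⟩
    obtain ⟨rfl, rfl⟩ := fin_eq (i := i) (j := i') (t := 0) (u := t) (by simpa using h1)
    exact h

lemma ext_T {T T' : Finset (PArc n)} (h1 : ∀ a b, IsChord T a b ↔ IsChord T' a b)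
    (h2 : ∀ a, IsRay T a ↔ IsRay T' a) : T = T' := by
  ext a
  cases a with
  | spoke i => rw [mem_ray, mem_ray, h2]
  | per i j => rw [mem_chord, mem_chord, h1]

lemma chord_shift {T : Finset (PArc n)} {a b : ℤ} (s : ℤ) (h : IsChord T a b) :
    IsChord T (a + s * n) (b + s * n) := by
  obtain ⟨i, j, h, t, rfl, rfl⟩ := h
  exact ⟨i, j, h, t + s, by ring, by ring⟩

lemma ray_shift {T : Finset (PArc n)} {a : ℤ} (s : ℤ) (h : IsRay T a) :
    IsRay T (a + s * n) := by
  obtain ⟨i, h, t, rfl⟩ := h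
  exact ⟨i, h, t + s, by ring⟩

lemma len_sub {N : ℕ} (i j c : Fin n) (hc : c.val = N % n) :
    PArc.len n (i - c) (j - c) = PArc.len n i j := by
  obtain ⟨t, ht⟩ := sub_spec i c hc
  obtain ⟨u, hu⟩ := sub_spec j c hc
  obtain ⟨h1, h2, w, hw⟩ := len_spec i j
  have := len_eq (i := i - c) (j := j - c) (l := PArc.len n i j) (t := w + t - u) (by omega) (by omega)
    (by rw [ht, hu]; linear_combination hw)
  exact_mod_cast this

lemma iff_of_down (P : ℤ → Prop) (N d : ℕ) (hd : 0 < d) (h1 : ∀ x, P x → P (x - N))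
    (h2 : ∀ x, P x → P (x + (N * d : ℕ))) (x : ℤ) : P x ↔ P (x + N) := by
  constructor
  · intro hx
    have h3 : ∀ k : ℕ, ∀ y, P y → P (y - k * N) := by
      intro k
      induction k with
      | zero => intro y hy; simpa using hy
      | succ k ih =>
        intro y hy
        have := h1 _ (ih y hy)
        rwa [show y - ((k + 1 : ℕ) : ℤ) * N = y - k * N - N by push_cast; ring]
    have h4 := h3 (d - 1) _ (h2 x hx)
    rwa [show x + ((N * d : ℕ) : ℤ) - ((d - 1 : ℕ) : ℤ) * N = x + N by
      push_cast [Nat.one_le_iff_ne_zero.2 hd.ne']; ring] at h4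
  · intro hx
    simpa using h1 _ hx

lemma ang_lift {m N d : ℕ} (hN : 0 < N) (hd : 0 < d) (hn : n = N * d) {T : Finset (PArc n)}
    (hT : IsAngulation n m T) (c : Fin n) (hc : c.val = N % n) (hrot : T.image (rotArc c) = T) :
    Lift m N (IsChord T) (IsRay T) := by
  obtain ⟨hv, hx, ⟨s0, hs0⟩, hf, hr⟩ := hT
  have hrot' : ∀ a ∈ T, rotArc c a ∈ T := fun a ha => by
    rw [← hrot]; exact Finset.mem_image_of_mem _ ha
  have perR : ∀ a, IsRay T a ↔ IsRay T (a + N) := by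
    refine iff_of_down _ N d hd ?_ ?_
    · rintro x ⟨i, hi, t, rfl⟩
      obtain ⟨u, hu⟩ := sub_spec i c hc
      exact ⟨i - c, hrot' _ hi, t - u, by rw [hu]; ring⟩
    · intro x hx'
      have := ray_shift 1 hx'
      rwa [← hn, ← one_mul (n : ℤ)]
  have perC : ∀ a b, IsChord T a b ↔ IsChord T (a + N) (b + N) := by
    intro a b
    have := iff_of_down (fun x => IsChord T (a + x) (b + x)) N d hd ?_ ?_ 0
    · simpa using this
    · rintro x ⟨i, j, hi, t, h1, h2⟩
      obtain ⟨u, hu⟩ := sub_spec i c hc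
      refine ⟨i - c, j - c, hrot' _ hi, t - u, ?_, ?_⟩
      · rw [hu]; linear_combination h1
      · rw [len_sub i j c hc]; linear_combination h2
    · intro x hx'
      have := chord_shift 1 hx'
      rwa [← hn, ← one_mul (n : ℤ), ← add_assoc, ← add_assoc]
  have nc : ∀ a b c d, IsChord T a b → IsChord T c d → a < c → c < b → b < d → False := by
    rintro a b e f ⟨i, j, hij, t, h1, h2⟩ ⟨k, l, hkl, u, h3, h4⟩ hae heb hbf
    obtain ⟨p1, p2, -⟩ := len_spec i j
    have hg := gp_eq (i := i) (j := k) (l := e - a) (t := u - t) (by omega) (by omega)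
      (by rw [sub_mul]; omega)
    refine hx _ hij _ hkl ?_ (Or.inl ⟨by omega, by omega, by omega⟩)
    intro heq
    injection heq with h5 h6
    subst h5
    have := uniq (n := n) (x := e) (y := a) (t := u - t) (by omega) (by omega)
      (by rw [sub_mul]; omega)
    omega
  refine ⟨perC, perR, ?_, ?_, nc, ?_, ?_, hf, hr⟩
  · rintro a b ⟨i, j, hij, t, h1, h2⟩
    have : 2 ≤ PArc.len n i j := hv _ hij
    omega
  · intro a b hab
    by_contra hcon
    exact nc a b (a + N) (b + N) hab ((perC a b).1 hab) (by omega) (by omega) (by omega)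
  · rintro a b x ⟨s, hs, u, h3⟩ ⟨i, j, hij, t, h1, h2⟩ hax hxb
    obtain ⟨p1, p2, -⟩ := len_spec i j
    have hg := gp_eq (i := i) (j := s) (l := x - a) (t := u - t) (by omega) (by omega)
      (by rw [sub_mul]; omega)
    refine hx _ hs _ hij (by simp) ?_
    exact ⟨by omega, by omega⟩
  · exact ⟨s0, (mem_ray s0).1 hs0⟩

/-- Arcs as a sum type. -/
def arcEquiv (n : ℕ) : PArc n ≃ Fin n ⊕ (Fin n × Fin n) where
  toFun a := match a with
    | .spoke i => Sum.inl i
    | .per i j => Sum.inr (i, j)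
  invFun x := match x with
    | Sum.inl i => .spoke i
    | Sum.inr (i, j) => .per i j
  left_inv a := by cases a <;> rfl
  right_inv x := by rcases x with i | ⟨i, j⟩ <;> rfl

instance (n : ℕ) : Fintype (PArc n) := Fintype.ofEquiv _ (arcEquiv n).symm

/-- Membership predicate for the arcs of a lifted angulation. -/
def arcP (n : ℕ) (C : ℤ → ℤ → Prop) (R : ℤ → Prop) : PArc n → Prop
  | .spoke i => R i.val
  | .per i j => C i.val (i.val + PArc.len n i j)

open Classical in
/-- The set of arcs whose lift is `(C, R)`. -/
noncomputable def mkT (n : ℕ) (C : ℤ → ℤ → Prop) (R : ℤ → Prop) : Finset (PArc n) :=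
  Finset.univ.filter (arcP n C R)

lemma mem_mkT {C : ℤ → ℤ → Prop} {R : ℤ → Prop} (a : PArc n) : a ∈ mkT n C R ↔ arcP n C R a := by
  simp [mkT]

lemma rot_inj {N : ℕ} (c : Fin n) (hc : c.val = N % n) : Function.Injective (rotArc c) := by
  have key : ∀ i j : Fin n, i - c = j - c → i = j := by
    intro i j h
    obtain ⟨t, ht⟩ := sub_spec i c hc
    obtain ⟨u, hu⟩ := sub_spec j c hc
    rw [h] at ht
    exact (fin_eq (t := t) (u := u) (by omega)).1
  intro a b h
  cases a <;> cases b <;> simp only [rotArc, PArc.spoke.injEq, PArc.per.injEq, reduceCtorEq] at h ⊢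
  · exact key _ _ h
  · exact ⟨key _ _ h.1, key _ _ h.2⟩

section mk
variable {m N d : ℕ} {C : ℤ → ℤ → Prop} {R : ℤ → Prop}

lemma Lift.perC_n (F : Lift m N C R) (hn : n = N * d) (t x y : ℤ) :
    C x y ↔ C (x + t * n) (y + t * n) := by
  rw [F.perC_mul (t * d), hn]; push_cast; ring_nf

lemma Lift.perR_n (F : Lift m N C R) (hn : n = N * d) (t x : ℤ) :
    R x ↔ R (x + t * n) := by
  rw [F.perR_mul (t * d), hn]; push_cast; ring_nf

lemma Lift.chord_mk (F : Lift m N C R) (hN : 0 < N) (hd : 0 < d) (hn : n = N * d) :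
    IsChord (mkT n C R) = C := by
  have hn0 : 0 < n := by rw [hn]; positivity
  have hNn : N ≤ n := by rw [hn]; exact Nat.le_mul_of_pos_right _ hd
  ext a b
  constructor
  · rintro ⟨i, j, h, t, rfl, rfl⟩
    rw [mem_mkT] at h
    have := (F.perC_n hn t _ _).1 h
    rwa [show (i.val : ℤ) + t * n + PArc.len n i j = i.val + PArc.len n i j + t * n by ring]
  · intro h
    have h1 := F.lo _ _ h
    have h2 := F.hi _ _ h
    obtain ⟨i, t, hi⟩ := repr_fin hn0 a
    obtain ⟨j, u, hj⟩ := repr_fin hn0 b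
    have hl := len_eq (i := i) (j := j) (l := b - a) (t := u - t) (by omega) (by omega)
      (by rw [sub_mul]; omega)
    refine ⟨i, j, ?_, t, hi, by omega⟩
    rw [mem_mkT]
    refine (F.perC_n hn t _ _).2 ?_
    rw [hl]
    convert h using 1 <;> omega

lemma Lift.ray_mk (F : Lift m N C R) (hN : 0 < N) (hd : 0 < d) (hn : n = N * d) :
    IsRay (mkT n C R) = R := by
  have hn0 : 0 < n := by rw [hn]; positivity
  ext a
  constructor
  · rintro ⟨i, h, t, rfl⟩
    rw [mem_mkT] at h
    exact (F.perR_n hn t _).1 h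
  · intro h
    obtain ⟨i, t, rfl⟩ := repr_fin hn0 a
    refine ⟨i, ?_, t, rfl⟩
    rw [mem_mkT]
    exact (F.perR_n hn t _).2 h

lemma Lift.noCross (F : Lift m N C R) (hn : n = N * d) (i j k l : Fin n)
    (h1 : C i.val (i.val + PArc.len n i j)) (h2 : C k.val (k.val + PArc.len n k l))
    (e1 : 0 < PArc.gp n i k) (e2 : PArc.gp n i k < PArc.len n i j)
    (e3 : PArc.len n i j < PArc.gp n i k + PArc.len n k l) : False := by
  obtain ⟨-, t, ht⟩ := gp_spec i k
  have h3 := (F.perC_n hn t _ _).1 h2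
  exact F.nc _ _ _ _ h1 h3 (by omega) (by omega) (by omega)

lemma Lift.noCrossRay (F : Lift m N C R) (hn : n = N * d) (i j s : Fin n)
    (h1 : C i.val (i.val + PArc.len n i j)) (h2 : R s.val)
    (e1 : 0 < PArc.gp n i s) (e2 : PArc.gp n i s < PArc.len n i j) : False := by
  obtain ⟨-, t, ht⟩ := gp_spec i s
  have h3 := (F.perR_n hn t _).1 h2
  exact F.ray _ _ _ h3 h1 (by omega) (by omega)

lemma Lift.ang_mk (F : Lift m N C R) (hN : 0 < N) (hd : 0 < d) (hn : n = N * d) :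
    IsAngulation n m (mkT n C R) := by
  have hn0 : 0 < n := by rw [hn]; positivity
  have eC := F.chord_mk hN hd hn
  have eR := F.ray_mk hN hd hn
  refine ⟨?_, ?_, ?_, ?_, ?_⟩
  · intro a ha
    rw [mem_mkT] at ha
    cases a with
    | spoke i => trivial
    | per i j =>
      have := F.lo _ _ ha
      show 2 ≤ PArc.len n i j
      omega
  · intro a ha b hb _
    rw [mem_mkT] at ha hb
    cases a with
    | spoke i =>
      cases b with
      | spoke j => exact fun h => h
      | per k l => exact fun h => F.noCrossRay hn k l i hb ha h.1 h.2
    | per i j =>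
      cases b with
      | spoke s => exact fun h => F.noCrossRay hn i j s ha hb h.1 h.2
      | per k l =>
        rintro (⟨e1, e2, e3⟩ | ⟨e1, e2, e3⟩)
        · exact F.noCross hn i j k l ha hb e1 e2 e3
        · exact F.noCross hn k l i j hb ha e1 e2 e3
  · obtain ⟨x, hx⟩ := F.ex
    rw [← eR] at hx
    obtain ⟨s, hs, -⟩ := hx
    exact ⟨s, hs⟩
  · intro S hS
    have : FinFace (IsChord (mkT n C R)) S := hS
    rw [eC] at this
    exact F.face S this
  · intro a b ha hb hab hno
    have h1 := F.rface a b (eR ▸ ha) (eR ▸ hb) hab (fun x e1 e2 => eR ▸ hno x e1 e2)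
    rw [← eC] at h1
    exact h1

lemma Lift.rot_mk (F : Lift m N C R) (hn : n = N * d)
    (c : Fin n) (hc : c.val = N % n) :
    (mkT n C R).image (rotArc c) = mkT n C R := by
  refine Finset.eq_of_subset_of_card_le ?_
    (Finset.card_image_of_injective _ (rot_inj c hc)).ge
  intro b hb
  obtain ⟨a, ha, rfl⟩ := Finset.mem_image.1 hb
  rw [mem_mkT] at ha ⊢
  cases a with
  | spoke i =>
    obtain ⟨t, ht⟩ := sub_spec i c hc
    show R _
    rw [ht, ← F.perR_n hn, F.perR, sub_add_cancel]
    exact ha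
  | per i j =>
    obtain ⟨t, ht⟩ := sub_spec i c hc
    show C _ _
    rw [len_sub i j c hc, ht,
      show (i.val : ℤ) - N + t * n + PArc.len n i j = (i.val + PArc.len n i j - N) + t * n by ring,
      ← F.perC_n hn, F.perC, sub_add_cancel, sub_add_cancel]
    exact ha

end mk

open Classical in
lemma spoke_count (T : Finset (PArc n)) :
    spokeCount T = ((Finset.Ico (0 : ℤ) n).filter (fun x => IsRay T x)).card := by
  unfold spokeCount
  refine Finset.card_bij (fun a _ => match a with
    | .spoke i => (i.val : ℤ)
    | .per i _ => (i.val : ℤ)) ?_ ?_ ?_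
  · intro a ha
    simp only [Finset.mem_filter] at ha
    cases a with
    | spoke i =>
      have := i.2
      simp only [Finset.mem_filter, Finset.mem_Ico]
      exact ⟨⟨by omega, by omega⟩, (mem_ray i).1 ha.1⟩
    | per i j => simp [PArc.isSpoke] at ha
  · intro a ha b hb e
    simp only [Finset.mem_filter] at ha hb
    cases a with
    | per i j => simp [PArc.isSpoke] at ha
    | spoke i =>
      cases b with
      | per i j => simp [PArc.isSpoke] at hb
      | spoke j =>
        congr 1
        apply Fin.ext
        have e' : (i.val : ℤ) = j.val := e
        exact_mod_cast e'
  · intro x hx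
    simp only [Finset.mem_filter, Finset.mem_Ico] at hx
    obtain ⟨⟨h1, h2⟩, i, hi, t, rfl⟩ := hx
    refine ⟨.spoke i, Finset.mem_filter.2 ⟨hi, rfl⟩, ?_⟩
    have := i.2
    have := uniq (n := n) (x := i.val + t * n) (y := i.val) (t := t) (by omega) (by omega) (by ring)
    exact this.symm

end arcs

section final

/-- The height function attached to `c`. -/
noncomputable def hgt (m : ℕ) (c : ℤ → ℕ) (x : ℤ) : ℤ :=
  (∑ i ∈ Finset.Ico 0 x, ((m : ℤ) * c i - 1)) - ∑ i ∈ Finset.Ico x 0, ((m : ℤ) * c i - 1)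

lemma hgt_step (m : ℕ) (c : ℤ → ℕ) (x : ℤ) : hgt m c (x + 1) = hgt m c x + m * c x - 1 := by
  unfold hgt
  rcases le_or_gt 0 x with h | h
  · have e : Finset.Ico 0 (x + 1) = insert x (Finset.Ico 0 x) := by
      ext y; simp only [Finset.mem_Ico, Finset.mem_insert]; omega
    rw [e, Finset.sum_insert (by simp), Finset.Ico_eq_empty (a := x + 1) (by omega),
      Finset.Ico_eq_empty (a := x) (by omega)]
    ring
  · have e : Finset.Ico x 0 = insert x (Finset.Ico (x + 1) 0) := by
      ext y; simp only [Finset.mem_Ico, Finset.mem_insert]; omega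
    rw [e, Finset.sum_insert (by simp), Finset.Ico_eq_empty (b := x + 1) (by omega),
      Finset.Ico_eq_empty (b := x) (by omega)]
    ring

lemma hgt_per (m N : ℕ) (c : ℤ → ℕ) (hc : ∀ x, c (x + N) = c x) (x : ℤ) :
    hgt m c (x + N) = hgt m c x - (N - m * (∑ i ∈ Finset.Ico (0 : ℤ) N, c i : ℕ)) := by
  have h0 : hgt m c N = m * (∑ i ∈ Finset.Ico (0 : ℤ) N, c i : ℕ) - N := by
    unfold hgt
    rw [Finset.Ico_eq_empty (a := (N : ℤ)) (by omega), Finset.sum_sub_distrib, ← Finset.mul_sum]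
    simp
  have h00 : hgt m c 0 = 0 := by simp [hgt]
  have hs : ∀ x, hgt m c (x + 1 + N) - hgt m c (x + 1) = hgt m c (x + N) - hgt m c x := by
    intro x
    rw [show x + 1 + (N : ℤ) = x + N + 1 by ring, hgt_step, hgt_step, hc]; ring
  have : hgt m c (x + N) - hgt m c x = hgt m c N := by
    induction x using Int.induction_on with
    | zero => simp [h00]
    | succ i ih => rw [hs, ih]
    | pred i ih =>
      rw [← hs, sub_add_cancel, ih]
  rw [h0] at this
  linarith

variable {N : ℕ}

/-- Periodic extension of a function on `Fin N`. -/
def pext (hN : 0 < N) (f : Fin N → ℕ) (x : ℤ) : ℕ :=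
  f ⟨(x % N).toNat, by
    have hN' : (0 : ℤ) < N := by exact_mod_cast hN
    have := Int.emod_nonneg x hN'.ne'
    have := Int.emod_lt_of_pos x hN'
    omega⟩

lemma pext_per (hN : 0 < N) (f : Fin N → ℕ) (x : ℤ) : pext hN f (x + N) = pext hN f x := by
  unfold pext
  congr 2
  simp

lemma pext_val (hN : 0 < N) (f : Fin N → ℕ) (i : Fin N) : pext hN f i.val = f i := by
  unfold pext
  congr 1
  apply Fin.ext
  have := i.2
  simp only
  rw [Int.emod_eq_of_lt (by omega) (by omega)]
  simp

lemma sum_Ico_fin (c : ℤ → ℕ) : ∑ i ∈ Finset.Ico (0 : ℤ) N, c i = ∑ i : Fin N, c i.val := by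
  symm
  refine Finset.sum_bij (fun i _ => (i.val : ℤ)) ?_ ?_ ?_ ?_
  · intro i _; have := i.2; simp
  · intro i _ j _ e; apply Fin.ext; exact_mod_cast e
  · intro x hx
    rw [Finset.mem_Ico] at hx
    exact ⟨⟨x.toNat, by omega⟩, Finset.mem_univ _, by simp [hx.1]⟩
  · intros; rfl

lemma pext_self (hN : 0 < N) (c : ℤ → ℕ) (hc : ∀ x, c (x + N) = c x) :
    pext hN (fun i => c i.val) = c := by
  have hN' : (0 : ℤ) < N := by exact_mod_cast hN
  have hmul : ∀ (t : ℤ) x, c (x + t * N) = c x := by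
    intro t x
    induction t using Int.induction_on with
    | zero => simp
    | succ i ih => rw [← ih, ← hc (x + i * N)]; congr 1; ring
    | pred i ih => rw [← ih, ← hc (x + (-(i : ℤ) - 1) * N)]; congr 1; ring
  ext x
  have h1 := Int.emod_add_mul_ediv x N
  have h2 := Int.emod_nonneg x hN'.ne'
  unfold pext
  simp only
  rw [Int.toNat_of_nonneg h2, ← hmul (x / N)]
  congr 1
  rw [mul_comm]; exact h1

lemma card_sum (N σ : ℕ) (hN : 0 < N) :
    Nat.card {f : Fin N → ℕ // ∑ i, f i = σ} = Nat.choose (N + σ - 1) (N - 1) := by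
  have h1 : Nat.card {f : Fin N → ℕ // ∑ i, f i = σ} = Nat.card (Sym (Fin N) σ) :=
    (Nat.card_congr (Sym.equivNatSumOfFintype (Fin N) σ)).symm
  rw [h1, Nat.card_eq_fintype_card, Sym.card_sym_eq_choose, Fintype.card_fin]
  rw [← Nat.choose_symm_of_eq_add]
  omega

lemma RH_congr {m : ℕ} {h : ℤ → ℤ} {ρ ρ' : ℤ} (e : (m : ℤ) ∣ ρ - ρ') : RH m h ρ = RH m h ρ' := by
  ext x
  unfold RH
  refine and_congr Iff.rfl ?_
  rw [show h x - ρ' = (h x - ρ) + (ρ - ρ') by ring]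
  exact (dvd_add_left e).symm

theorem main_card (m L k N d n : ℕ) (hm : 0 < m) (hL : 0 < L) (hNL : N = m * L)
    (hd : 0 < d) (hn : n = N * d) (hk : 1 ≤ k) (hkL : k ≤ L) (c0 : Fin n) (hc0 : c0.val = N % n) :
    Nat.card {T : Finset (PArc n) // IsAngulation n m T ∧ spokeCount T = k * d ∧
      T.image (rotArc c0) = T} = m * Nat.choose (N + L - k - 1) (N - 1) := by
  have hN : 0 < N := by rw [hNL]; positivity
  have hm' : (0 : ℤ) < m := by exact_mod_cast hm
  -- the height data of a function
  have HT : ∀ f : {f : Fin N → ℕ // ∑ i, f i = L - k},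
      Ht m N (pext hN f.1) (hgt m (pext hN f.1)) (m * k) := by
    rintro ⟨f, hf⟩
    have e : (∑ i ∈ Finset.Ico (0 : ℤ) N, pext hN f i) = L - k := by
      rw [sum_Ico_fin, ← hf]
      exact Finset.sum_congr rfl fun i _ => pext_val hN f i
    refine ⟨hgt_step _ _, fun x => ?_, by positivity⟩
    rw [hgt_per m N _ (pext_per hN f), e, Nat.cast_sub hkL]
    have hz : (N : ℤ) = m * L := by rw [hNL]; push_cast; ring
    simp only
    linear_combination -hz
  have HL := fun (f : {f : Fin N → ℕ // ∑ i, f i = L - k}) (ρ : Fin m) =>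
    (HT f).lift hm hN (Dvd.intro _ rfl) (ρ.val : ℤ)
  have HRLn : ∀ {c h D}, Ht m N c h D → ∀ x, RL h x ↔ RL h (x + (n : ℤ)) := by
    intro c h D H x
    have : ∀ j : ℕ, RL h x ↔ RL h (x + j * N) := by
      intro j
      induction j with
      | zero => simp
      | succ j ih => rw [ih, H.RL_per]; push_cast; ring_nf
    rw [this d, hn]; push_cast; ring_nf
  let G : {f : Fin N → ℕ // ∑ i, f i = L - k} × Fin m →
      {T : Finset (PArc n) // IsAngulation n m T ∧ spokeCount T = k * d ∧
      T.image (rotArc c0) = T} := fun y =>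
    ⟨mkT n (CH m (hgt m (pext hN y.1.1))) (RH m (hgt m (pext hN y.1.1)) (y.2.val : ℤ)),
      (HL y.1 y.2).ang_mk hN hd hn, by
        rw [spoke_count, (HL y.1 y.2).ray_mk hN hd hn]
        refine (HT y.1).ray_count hm hN _ n (k * d) (fun x => ?_) (HRLn (HT y.1))
        have := (HT y.1).per_mul d x
        rw [show x + (n : ℤ) = x + d * N by rw [hn]; push_cast; ring, this]
        push_cast; ring, (HL y.1 y.2).rot_mk hn c0 hc0⟩
  have hG : Function.Bijective G := by
    constructor
    · rintro ⟨f, ρ⟩ ⟨f', ρ'⟩ e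
      have e1 : mkT n (CH m (hgt m (pext hN f.1))) (RH m (hgt m (pext hN f.1)) (ρ.val : ℤ)) =
        mkT n (CH m (hgt m (pext hN f'.1))) (RH m (hgt m (pext hN f'.1)) (ρ'.val : ℤ)) :=
        congrArg Subtype.val e
      have eC : CH m (hgt m (pext hN f.1)) = CH m (hgt m (pext hN f'.1)) := by
        rw [← (HL f ρ).chord_mk hN hd hn, e1, (HL f' ρ').chord_mk hN hd hn]
      have eR : RH m (hgt m (pext hN f.1)) (ρ.val : ℤ) = RH m (hgt m (pext hN f'.1)) (ρ'.val : ℤ) := by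
        rw [← (HL f ρ).ray_mk hN hd hn, e1, (HL f' ρ').ray_mk hN hd hn]
      have ec : ∀ a, pext hN f.1 a = pext hN f'.1 a := by
        intro a
        rw [← CH_card (HT f).step hm ((HT f).right hN) a, eC,
          CH_card (HT f').step hm ((HT f').right hN) a]
      have ef : f = f' := by
        apply Subtype.ext
        ext i
        rw [← pext_val hN f.1, ec, pext_val hN f'.1]
      subst ef
      obtain ⟨r, hr⟩ := (HL f ρ).ex
      have hr' := hr
      rw [eR] at hr'
      have hdv := dvd_sub hr'.2 hr.2
      rw [sub_sub_sub_cancel_left] at hdv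
      have h1 := ρ.2
      have h2 := ρ'.2
      have := Int.eq_zero_of_abs_lt_dvd hdv (abs_lt.2 ⟨by omega, by omega⟩)
      have e3 : ρ = ρ' := Fin.ext (by omega)
      rw [e3]
    · rintro ⟨T, hT, hs, hrot⟩
      have F := ang_lift hN hd hn hT c0 hc0 hrot
      set c : ℤ → ℕ := fun a => {b | IsChord T a b}.ncard with hc
      have hcper : ∀ x, c (x + N) = c x := fun x => F.cper x
      have epext := pext_self hN c hcper
      set σ := ∑ i : Fin N, c i.val with hσ
      have hper := hgt_per m N c hcper
      rw [sum_Ico_fin, ← hσ] at hper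
      have H := F.ht hN (fun a => rfl) (hgt_step m c) hper
      have hD : (N : ℤ) - m * σ = m * (L - σ) := by rw [hNL]; push_cast; ring
      rw [hD] at H
      have hpos := H.pos
      have hσL : σ < L := by
        have := pos_of_mul_pos_right hpos hm'.le
        omega
      have eC := F.eq_CH hN (fun a => rfl) (hgt_step m c)
      obtain ⟨r, hr⟩ := F.ex
      have eR := F.eq_RH hm hN H eC (Dvd.intro _ rfl) hr
      have hcount : spokeCount T = (L - σ) * d := by
        rw [spoke_count, eR]
        refine H.ray_count hm hN _ n ((L - σ) * d) (fun x => ?_) (HRLn H)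
        have := H.per_mul d x
        rw [show x + (n : ℤ) = x + d * N by rw [hn]; push_cast; ring, this]
        push_cast [hσL.le]; ring
      have hkσ : L - σ = k := by
        rw [hs] at hcount
        exact (Nat.eq_of_mul_eq_mul_right hd hcount).symm
      have h2 := Int.emod_nonneg (hgt m c r) hm'.ne'
      have h3 := Int.emod_lt_of_pos (hgt m c r) hm'
      refine ⟨(⟨fun i => c i.val, by show σ = L - k; omega⟩, ⟨(hgt m c r % m).toNat, by omega⟩), ?_⟩
      apply Subtype.ext
      show mkT n (CH m (hgt m (pext hN fun i => c i.val)))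
        (RH m (hgt m (pext hN fun i => c i.val)) (((hgt m c r % m).toNat : ℕ) : ℤ)) = T
      rw [epext, Int.toNat_of_nonneg h2,
        RH_congr (ρ' := hgt m c r) (by
          rw [← neg_sub, Int.dvd_neg]; exact Int.dvd_self_sub_emod), ← eC, ← eR]
      exact ext_T (fun a b => by rw [F.chord_mk hN hd hn]) (fun a => by rw [F.ray_mk hN hd hn])
  rw [← Nat.card_congr (Equiv.ofBijective G hG), Nat.card_prod, card_sum N _ hN, Nat.card_fin, mul_comm]
  congr 2
  omega

lemma rot_zero {n : ℕ} (c : Fin n) (hc : c.val = n % n) (T : Finset (PArc n)) :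
    T.image (rotArc c) = T := by
  have key : ∀ i : Fin n, i - c = i := by
    intro i
    obtain ⟨t, ht⟩ := sub_spec i c hc
    exact (fin_eq (t := 0) (u := t - 1) (by rw [ht]; ring)).1
  have : rotArc c = id := by
    funext a
    cases a <;> simp [rotArc, key]
  rw [this, Finset.image_id]

end final

end PAng

/-- if `d` divides `n`, `s` and `ℓ = n/m`, then the `(m+2)`-angulations
of `P_n^•` with `s` spokes that are fixed under rotation by `2π/d` (i.e. by `n/d` vertex
positions) are in bijection with `(m+2)`-angulations of `P_{n/d}^•` with `s/d` spokes;
consequently their number is `m·C(n/d + ℓ/d - s/d - 1, n/d - 1)`. -/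
theorem stmt13 (m ℓ s d n : ℕ) (hm : 0 < m) (hl : 0 < ℓ) (hn : n = m * ℓ)
    (hs1 : 1 ≤ s) (hsl : s ≤ ℓ) (hd : 0 < d)
    (hdn : d ∣ n) (hds : d ∣ s) (hdl : d ∣ ℓ) :
    Nonempty
      ({T : Finset (PArc n) // IsAngulation n m T ∧ spokeCount T = s ∧
          T.image (rotArc ⟨n / d % n, Nat.mod_lt _ (by rw [hn]; exact Nat.mul_pos hm hl)⟩) = T}
        ≃ {T' : Finset (PArc (n / d)) // IsAngulation (n / d) m T' ∧ spokeCount T' = s / d}) ∧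
    Nat.card {T : Finset (PArc n) // IsAngulation n m T ∧ spokeCount T = s ∧
        T.image (rotArc ⟨n / d % n, Nat.mod_lt _ (by rw [hn]; exact Nat.mul_pos hm hl)⟩) = T}
      = m * Nat.choose (n / d + ℓ / d - s / d - 1) (n / d - 1) := by
  have hn0 : 0 < n := by rw [hn]; exact Nat.mul_pos hm hl
  obtain ⟨L, rfl⟩ := hdl
  obtain ⟨k, rfl⟩ := hds
  have hL : 0 < L := Nat.pos_of_mul_pos_left hl
  have eL : d * L / d = L := Nat.mul_div_cancel_left _ hd
  have ek : d * k / d = k := Nat.mul_div_cancel_left _ hd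
  have eN : n / d = m * L := by
    rw [hn, Nat.mul_left_comm, Nat.mul_div_cancel_left _ hd]
  have hN0 : 0 < n / d := by rw [eN]; exact Nat.mul_pos hm hL
  have hk : 1 ≤ k := Nat.pos_of_mul_pos_left hs1
  have hkL : k ≤ L := Nat.le_of_mul_le_mul_left hsl hd
  rw [eL, ek]
  have h1 := PAng.main_card m L k (n / d) d n hm hL eN hd (Nat.div_mul_cancel hdn).symm hk hkL
    ⟨n / d % n, Nat.mod_lt _ hn0⟩ rfl
  have h2 := PAng.main_card m L k (n / d) 1 (n / d) hm hL eN one_pos (mul_one _).symm hk hkL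
    ⟨n / d % (n / d), Nat.mod_lt _ hN0⟩ rfl
  rw [mul_comm k d] at h1
  rw [mul_one] at h2
  have h3 : Nat.card {T' : Finset (PArc (n / d)) // IsAngulation (n / d) m T' ∧ spokeCount T' = k}
      = m * Nat.choose (n / d + L - k - 1) (n / d - 1) := by
    rw [← h2]
    refine Nat.card_congr (Equiv.subtypeEquivRight fun T => ?_)
    rw [and_iff_left (PAng.rot_zero _ rfl T)]
  exact ⟨Finite.card_eq.1 (h1.trans h3.symm), h1⟩
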